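/- arXiv:2101.02116 — 2 statements merged into one kernel-verified Lean document; each statement's English description precedes it below -/
import Mathlib

section
/- (Semiclassical maximum principle.) For all constants C > 0 and L > 0 there exists ℏ₀ ∈ (0, 1] such that the following holds for every ℏ ∈ (0, ℏ₀]: let w ∈ ℝ, 0 < δ < 1 and β > 0 satisfy β² ≥ C ℏ^{−3L} δ², set Ω := (w − 2β, w + 2β) + i(−δ ℏ^{−L}, δ) ⊂ ℂ, and let Q be a holomorphic B(ℋ)-valued function on an open neighborhood of the closure of Ω satisfying ‖Q(z)‖ ≤ exp(C ℏ^{−L}) for all z ∈ Ω, and ‖Q(z)‖ ≤ C / Im z for all z ∈ Ω with Im z > 0. Then ‖Q(z)‖ ≤ (C/δ) · exp(C + 1) for every real z ∈ [w − β, w + β]. -/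
open scoped ComplexConjugate

/-- The open rectangle `(w - 2β, w + 2β) + i(-γ₋, γ₊)` in the complex plane. -/
def openRect (w β γneg γpos : ℝ) : Set ℂ :=
  {z : ℂ | w - 2 * β < z.re ∧ z.re < w + 2 * β ∧ -γneg < z.im ∧ z.im < γpos}

theorem openRect_eq_reProdIm (w β γneg γpos : ℝ) :
    openRect w β γneg γpos = Set.Ioo (w - 2 * β) (w + 2 * β) ×ℂ Set.Ioo (-γneg) γpos := by
  ext z
  simp only [openRect, Set.mem_ofPred_eq, Complex.mem_reProdIm, Set.mem_Ioo]
  tauto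

theorem closure_openRect {w β γneg γpos : ℝ} (hβ : 0 < β) (hγ : -γneg < γpos) :
    closure (openRect w β γneg γpos) =
      Set.Icc (w - 2 * β) (w + 2 * β) ×ℂ Set.Icc (-γneg) γpos := by
  rw [openRect_eq_reProdIm, Complex.closure_reProdIm, closure_Ioo (by linarith),
    closure_Ioo hγ.ne]

theorem isOpen_openRect (w β γneg γpos : ℝ) : IsOpen (openRect w β γneg γpos) := by
  rw [openRect_eq_reProdIm]
  exact isOpen_Ioo.reProdIm isOpen_Ioo

theorem isBounded_openRect (w β γneg γpos : ℝ) :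
    Bornology.IsBounded (openRect w β γneg γpos) := by
  rw [openRect_eq_reProdIm]
  exact (Metric.isBounded_Ioo _ _).reProdIm (Metric.isBounded_Ioo _ _)

/-- The modulus of the weight `exp (-i k (z - x) - b (z - x)²)`. -/
theorem norm_exp_tilted_gaussian (k b x : ℝ) (z : ℂ) :
    ‖Complex.exp (-Complex.I * k * (z - x) - b * (z - x) ^ 2)‖ =
      Real.exp (k * z.im + b * z.im ^ 2 - b * (z.re - x) ^ 2) := by
  rw [Complex.norm_exp]
  congr 1
  simp [pow_two]
  ring

/-- A bound `‖Q z‖ * Im z ≤ C` in the part of a rectangle above the real axis persists on the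
upper edge of its closure. -/
theorem norm_mul_le_of_im_eq {E : Type*} [NormedAddCommGroup E] {Q : ℂ → E}
    {w β γneg γpos C : ℝ} (hβ : 0 < β) (hneg : 0 ≤ γneg) (hpos : 0 < γpos)
    (hQ : ContinuousOn Q (closure (openRect w β γneg γpos)))
    (hbound : ∀ z ∈ openRect w β γneg γpos, 0 < z.im → ‖Q z‖ * z.im ≤ C)
    {z : ℂ} (hz : z ∈ closure (openRect w β γneg γpos)) (him : z.im = γpos) :
    ‖Q z‖ * γpos ≤ C := by
  have hsub : openRect w β 0 γpos ⊆ openRect w β γneg γpos := fun z hz =>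
    ⟨hz.1, hz.2.1, by linarith [hz.2.2.1], hz.2.2.2⟩
  have hz' : z ∈ closure (openRect w β 0 γpos) := by
    rw [closure_openRect hβ (by linarith)] at hz ⊢
    exact ⟨hz.1, by simp [him, hpos.le]⟩
  have hcont : ContinuousWithinAt (fun z => ‖Q z‖ * z.im) (openRect w β 0 γpos) z :=
    ((hQ z hz).mono (hsub.trans subset_closure)).norm.mul
      Complex.continuous_im.continuousWithinAt
  simpa [him] using hcont.closure_le hz' continuousWithinAt_const fun y hy =>
    hbound y (hsub hy) (by simpa using hy.2.2.1)

/-- A holomorphic function that is at most `A` on a rectangle, with `‖Q z‖ * Im z ≤ C` above the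
real axis, is at most `B` at a real point `x` as soon as the weighted bounds on the vertical,
lower and upper edges are at most `B`. -/
theorem norm_le_of_tilted_gaussian_bounds {E : Type*} [NormedAddCommGroup E] [NormedSpace ℂ E]
    {Q : ℂ → E} {w β γneg γpos A B C k b x : ℝ} (hβ : 0 < β) (hneg : 0 ≤ γneg) (hpos : 0 < γpos)
    (hb : 0 ≤ b) (hQ : DiffContOnCl ℂ Q (openRect w β γneg γpos))
    (hA : ∀ z ∈ openRect w β γneg γpos, ‖Q z‖ ≤ A)
    (hC : ∀ z ∈ openRect w β γneg γpos, 0 < z.im → ‖Q z‖ ≤ C / z.im)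
    (hx₁ : w - β ≤ x) (hx₂ : x ≤ w + β)
    (hside : ∀ y, -γneg ≤ y → y ≤ γpos → Real.exp (k * y + b * y ^ 2 - b * β ^ 2) * A ≤ B)
    (hbottom : Real.exp (k * -γneg + b * γneg ^ 2) * A ≤ B)
    (htop : Real.exp (k * γpos + b * γpos ^ 2) * (C / γpos) ≤ B) :
    ‖Q x‖ ≤ B := by
  have hcl := closure_openRect (w := w) (γneg := γneg) (γpos := γpos) hβ (by linarith)
  have hA' : ∀ z ∈ closure (openRect w β γneg γpos), ‖Q z‖ ≤ A := fun z hz =>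
    ((hQ.continuousOn z hz).mono subset_closure).norm.closure_le hz continuousWithinAt_const hA
  have hxcl : (x : ℂ) ∈ closure (openRect w β γneg γpos) := by
    rw [hcl]
    simp only [Complex.mem_reProdIm, Complex.ofReal_re, Complex.ofReal_im, Set.mem_Icc]
    exact ⟨⟨by linarith, by linarith⟩, by linarith, hpos.le⟩
  have hA0 : 0 ≤ A := (norm_nonneg _).trans (hA' _ hxcl)
  have hweight : DiffContOnCl ℂ
      (fun z : ℂ => Complex.exp (-Complex.I * k * (z - x) - b * (z - x) ^ 2))
      (openRect w β γneg γpos) :=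
    Differentiable.diffContOnCl (by fun_prop)
  have hmax := Complex.norm_le_of_forall_mem_frontier_norm_le (C := B)
    (isBounded_openRect w β γneg γpos) (hweight.smul hQ) ?_ hxcl
  · simpa using hmax
  rintro z hz
  have hzcl := frontier_subset_closure hz
  have hznot : z ∉ openRect w β γneg γpos := by
    rw [(isOpen_openRect w β γneg γpos).frontier_eq] at hz
    exact hz.2
  rw [norm_smul, norm_exp_tilted_gaussian]
  have hmem := hzcl
  rw [hcl] at hmem
  obtain ⟨⟨hr₁, hr₂⟩, hi₁, hi₂⟩ := hmem
  have hsq : 0 ≤ b * (z.re - x) ^ 2 := by positivity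
  by_cases hre : β ^ 2 ≤ (z.re - x) ^ 2
  · refine le_trans ?_ (hside z.im hi₁ hi₂)
    gcongr
    exact hA' z hzcl
  have hre' := abs_lt_of_sq_lt_sq (not_le.mp hre) hβ.le
  rw [abs_lt] at hre'
  by_cases htopedge : z.im = γpos
  · refine le_trans ?_ htop
    rw [htopedge]
    have hn : ‖Q z‖ ≤ C / γpos := by
      rw [le_div_iff₀ hpos]
      exact norm_mul_le_of_im_eq hβ hneg hpos hQ.continuousOn
        (fun z hz hzim => (le_div_iff₀ hzim).mp (hC z hz hzim)) hzcl htopedge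
    gcongr
    linarith
  by_cases hbotedge : z.im = -γneg
  · refine le_trans ?_ hbottom
    rw [hbotedge]
    gcongr
    · nlinarith
    · exact hA' z hzcl
  refine absurd ⟨?_, ?_, lt_of_le_of_ne hi₁ (Ne.symm hbotedge), lt_of_le_of_ne hi₂ htopedge⟩ hznot
  · linarith [hre'.1]
  · linarith [hre'.2]

theorem tilted_gaussian_exponent_le {C M δ c y : ℝ} (hC : 0 < C) (hδ : 0 < δ) (hM : 1 ≤ M)
    (hc : 2 ≤ c) (hcM : c + 2 ≤ M) (hy₁ : -(δ * M) ≤ y) (hy₂ : y ≤ δ) :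
    (C + c / M) / δ * y + 2 / (δ * M) ^ 2 * y ^ 2 ≤ C + 1 := by
  have hM0 : 0 < M := by linarith
  obtain ⟨t, rfl⟩ : ∃ t, y = δ * t := ⟨y / δ, by field_simp⟩
  have ht₁ : -M ≤ t := by nlinarith
  have ht₂ : t ≤ 1 := by nlinarith
  have heq : (C + c / M) / δ * (δ * t) + 2 / (δ * M) ^ 2 * (δ * t) ^ 2 =
      C * t + (c * M * t + 2 * t ^ 2) / M ^ 2 := by
    field_simp
    ring
  have hfrac : (c * M * t + 2 * t ^ 2) / M ^ 2 ≤ 1 := by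
    rw [div_le_one (by positivity)]
    rcases le_total t 0 with h | h
    · nlinarith [mul_nonneg (neg_nonneg.mpr h) (by linarith : (0 : ℝ) ≤ t + M),
        mul_nonneg (mul_nonneg (neg_nonneg.mpr h) hM0.le) (by linarith : (0 : ℝ) ≤ c - 2)]
    · nlinarith [mul_nonneg (mul_nonneg (by linarith : (0 : ℝ) ≤ c) hM0.le)
        (by linarith : (0 : ℝ) ≤ 1 - t)]
  rw [heq]
  nlinarith

theorem exists_forall_le_rpow_neg {L : ℝ} (hL : 0 < L) {M₀ : ℝ} (hM₀ : 1 ≤ M₀) :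
    ∃ ℏ₀ : ℝ, 0 < ℏ₀ ∧ ℏ₀ ≤ 1 ∧ ∀ ℏ : ℝ, 0 < ℏ → ℏ ≤ ℏ₀ → M₀ ≤ ℏ ^ (-L) := by
  have h0 : 0 < M₀ := by linarith
  refine ⟨M₀ ^ (-L⁻¹), by positivity,
    Real.rpow_le_one_of_one_le_of_nonpos hM₀ (by simp [hL.le]), fun ℏ hℏ hle => ?_⟩
  calc M₀ = (M₀ ^ (-L⁻¹)) ^ (-L) := by
        rw [← Real.rpow_mul h0.le, neg_mul_neg, inv_mul_cancel₀ hL.ne', Real.rpow_one]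
    _ ≤ ℏ ^ (-L) := Real.rpow_le_rpow_of_nonpos hℏ hle (by linarith)

/-- **Semiclassical maximum principle.**
For all `C, L > 0` there is `ℏ₀ ∈ (0,1]` such that for all `ℏ ∈ (0, ℏ₀]`, `w ∈ ℝ`,
`0 < δ < 1` and `β > 0` with `β² ≥ C ℏ^(-3L) δ²`, and any family `Q` of bounded operators
on a complex Hilbert space `ℋ`, holomorphic on an open neighbourhood of the closure of
`Ω = (w - 2β, w + 2β) + i(-δ ℏ^{-L}, δ)`, satisfying `‖Q z‖ ≤ exp (C ℏ^{-L})` on `Ω`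
and `‖Q z‖ ≤ C / Im z` on `Ω ∩ {Im z > 0}`, one has `‖Q z‖ ≤ (C/δ) exp (C+1)` for all
real `z ∈ [w - β, w + β]`. -/
theorem semiclassical_maximum_principle (C L : ℝ) (hC : 0 < C) (hL : 0 < L) :
    ∃ ℏ₀ : ℝ, 0 < ℏ₀ ∧ ℏ₀ ≤ 1 ∧
      ∀ ℏ : ℝ, 0 < ℏ → ℏ ≤ ℏ₀ →
      ∀ w δ β : ℝ, 0 < δ → δ < 1 → 0 < β →
        C * ℏ ^ (-(3 * L)) * δ ^ 2 ≤ β ^ 2 →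
      ∀ (ℋ : Type) [NormedAddCommGroup ℋ] [InnerProductSpace ℂ ℋ]
        [CompleteSpace ℋ],
      ∀ (Q : ℂ → ℋ →L[ℂ] ℋ) (U : Set ℂ),
        IsOpen U →
        closure (openRect w β (δ * ℏ ^ (-L)) δ) ⊆ U →
        DifferentiableOn ℂ Q U →
        (∀ z ∈ openRect w β (δ * ℏ ^ (-L)) δ, ‖Q z‖ ≤ Real.exp (C * ℏ ^ (-L))) →
        (∀ z ∈ openRect w β (δ * ℏ ^ (-L)) δ, 0 < z.im → ‖Q z‖ ≤ C / z.im) →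
        ∀ x : ℝ, w - β ≤ x → x ≤ w + β →
          ‖Q (x : ℂ)‖ ≤ (C / δ) * Real.exp (C + 1) := by
  set c : ℝ := 2 + |Real.log C| with hc_def
  have hc : 2 ≤ c := by simp [hc_def]
  have hlogC : 0 ≤ |Real.log C| / C := by positivity
  obtain ⟨ℏ₀, hℏ₀, hℏ₀_le, hlarge⟩ :=
    exists_forall_le_rpow_neg hL (M₀ := c + 2 + |Real.log C| / C) (by linarith)
  refine ⟨ℏ₀, hℏ₀, hℏ₀_le, ?_⟩
  intro ℏ hℏ hℏ_le w δ β hδ hδ1 hβ hβδ ℋ _ _ _ Q U _ hU hQ hexp hres x hx₁ hx₂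
  have hM := hlarge ℏ hℏ hℏ_le
  have hcube : ℏ ^ (-(3 * L)) = (ℏ ^ (-L)) ^ 3 := by
    rw [← Real.rpow_natCast, ← Real.rpow_mul hℏ.le]
    congr 1
    push_cast
    ring
  rw [hcube] at hβδ
  set M : ℝ := ℏ ^ (-L)
  have hM1 : 1 ≤ M := by linarith
  have hcM : c + 2 ≤ M := by linarith
  have hM0 : 0 < M := by linarith
  have hCM : |Real.log C| ≤ C * M := by
    rw [← div_le_iff₀' hC]
    linarith
  have hlog := neg_abs_le (Real.log C)
  have hle : ∀ s, s ≤ Real.log C + C + 1 → Real.exp s ≤ C / δ * Real.exp (C + 1) := by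
    intro s hs
    calc Real.exp s ≤ Real.exp (Real.log C + (C + 1)) := Real.exp_le_exp.mpr (by linarith)
      _ = C * Real.exp (C + 1) := by rw [Real.exp_add, Real.exp_log hC]
      _ ≤ C / δ * Real.exp (C + 1) := by
        gcongr
        exact le_div_self hC.le hδ hδ1.le
  refine norm_le_of_tilted_gaussian_bounds (k := (C + c / M) / δ) (b := 2 / (δ * M) ^ 2)
    hβ (by positivity) hδ (by positivity)
    (hQ.mono hU).diffContOnCl hexp hres hx₁ hx₂ ?_ ?_ ?_
  · intro y hy₁ hy₂
    have hy := tilted_gaussian_exponent_le hC hδ hM1 hc hcM hy₁ hy₂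
    have hgauss : 2 * C * M ≤ 2 / (δ * M) ^ 2 * β ^ 2 := by
      calc 2 * C * M = 2 / (δ * M) ^ 2 * (C * M ^ 3 * δ ^ 2) := by field_simp
        _ ≤ _ := by gcongr
    rw [← Real.exp_add]
    exact hle _ (by linarith)
  · rw [← Real.exp_add]
    refine hle _ ?_
    have heq : (C + c / M) / δ * -(δ * M) + 2 / (δ * M) ^ 2 * (δ * M) ^ 2 + C * M = 2 - c := by
      field_simp
      ring
    rw [heq]
    linarith
  · rw [mul_comm]
    refine mul_le_mul_of_nonneg_left (Real.exp_le_exp.mpr ?_) (by positivity)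
    refine tilted_gaussian_exponent_le hC hδ hM1 hc hcM ?_ le_rfl
    linarith [mul_pos hδ hM0]
end

section
/- (Rank bound from almost orthonormal vectors nearly in the range of a projection.) Let ℋ be a complex Hilbert space and let Π : ℋ → ℋ be a bounded orthogonal projection (Π ∘ Π = Π and Π self-adjoint) whose range is finite dimensional, of dimension R. Let N ≥ 1, let ε, η ≥ 0, and let u₁, …, u_N ∈ ℋ be unit vectors such that |⟨u_i, u_j⟩| ≤ ε for all i ≠ j and ‖u_i − Π u_i‖ ≤ η for all i. If ε + 2η < 1/N, then N ≤ R. -/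
open scoped InnerProductSpace

/-- Vectors whose Gram matrix is strictly diagonally dominant are linearly independent. -/
theorem linearIndependent_of_sum_norm_inner_lt {𝕜 E ι : Type*} [RCLike 𝕜]
    [NormedAddCommGroup E] [InnerProductSpace 𝕜 E] [Fintype ι] [DecidableEq ι] {v : ι → E}
    (h : ∀ i, ∑ j ∈ Finset.univ.erase i, ‖inner 𝕜 (v i) (v j)‖ < ‖inner 𝕜 (v i) (v i)‖) :
    LinearIndependent 𝕜 v :=
  Matrix.linearIndependent_of_det_gram_ne_zero (𝕜 := 𝕜) <|
    det_ne_zero_of_sum_row_lt_diag <| by simpa [Matrix.gram_apply] using h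

/-- Applying a symmetric idempotent to unit vectors perturbs their inner products by at most the
distance from the first vector to its image. -/
theorem norm_inner_sub_inner_map_le {𝕜 E : Type*} [RCLike 𝕜] [NormedAddCommGroup E]
    [InnerProductSpace 𝕜 E] {P : E → E} (hidem : ∀ x, P (P x) = P x)
    (hsa : ∀ x y, inner 𝕜 (P x) y = inner 𝕜 x (P y)) (x : E) {y : E} (hy : ‖y‖ = 1) :
    ‖inner 𝕜 x y - inner 𝕜 (P x) (P y)‖ ≤ ‖x - P x‖ := by
  rw [← hsa, hidem, ← inner_sub_left]
  simpa [hy] using norm_inner_le_norm (𝕜 := 𝕜) (x - P x) y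

/-- **Rank bound from almost orthonormal vectors nearly in the range of a projection.**
Let `P` be a bounded orthogonal projection on a complex Hilbert space `ℋ` with finite
dimensional range of dimension `R`. If `u 1, …, u N` are unit vectors with
`|⟨u i, u j⟩| ≤ ε` for `i ≠ j` and `‖u i - P (u i)‖ ≤ η` for all `i`, and `ε + 2η < 1/N`,
then `N ≤ R`. -/
theorem rank_lower_bound_of_almost_orthonormal
    {H : Type*} [NormedAddCommGroup H] [InnerProductSpace ℂ H] [CompleteSpace H]
    (P : H →L[ℂ] H)
    (hidem : ∀ x : H, P (P x) = P x)
    (hsa : ∀ x y : H, ⟪P x, y⟫_ℂ = ⟪x, P y⟫_ℂ)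
    (R : ℕ)
    (hfin : FiniteDimensional ℂ (LinearMap.range (P : H →ₗ[ℂ] H)))
    (hR : Module.finrank ℂ (LinearMap.range (P : H →ₗ[ℂ] H)) = R)
    (N : ℕ) (hN : 1 ≤ N) (ε η : ℝ) (hε : 0 ≤ ε) (hη : 0 ≤ η)
    (u : Fin N → H)
    (hunit : ∀ i, ‖u i‖ = 1)
    (horth : ∀ i j, i ≠ j → ‖(⟪u i, u j⟫_ℂ : ℂ)‖ ≤ ε)
    (hproj : ∀ i, ‖u i - P (u i)‖ ≤ η)
    (hsmall : ε + 2 * η < 1 / (N : ℝ)) :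
    N ≤ R := by
  have hNη : N * (ε + 2 * η) < 1 := by
    rwa [lt_div_iff₀' (by exact_mod_cast hN)] at hsmall
  have hdist (i j : Fin N) : ‖⟪u i, u j⟫_ℂ - ⟪P (u i), P (u j)⟫_ℂ‖ ≤ η :=
    (norm_inner_sub_inner_map_le hidem hsa (u i) (hunit j)).trans (hproj i)
  have hdiag (i : Fin N) : 1 - η ≤ ‖⟪P (u i), P (u i)⟫_ℂ‖ := by
    have hone : ‖⟪u i, u i⟫_ℂ‖ = 1 := by simp [inner_self_eq_norm_sq_to_K, hunit i]
    linarith [hdist i i, norm_sub_norm_le ⟪u i, u i⟫_ℂ ⟪P (u i), P (u i)⟫_ℂ]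
  have hoff (i j : Fin N) (hij : i ≠ j) : ‖⟪P (u i), P (u j)⟫_ℂ‖ ≤ ε + η := by
    linarith [hdist i j, horth i j hij,
      norm_le_norm_add_norm_sub ⟪u i, u j⟫_ℂ ⟪P (u i), P (u j)⟫_ℂ]
  let v (i : Fin N) : LinearMap.range (P : H →ₗ[ℂ] H) := ⟨P (u i), u i, rfl⟩
  have hv : LinearIndependent ℂ v := linearIndependent_of_sum_norm_inner_lt fun i => by
    refine lt_of_lt_of_le ?_ (hdiag i)
    calc ∑ j ∈ Finset.univ.erase i, ‖⟪P (u i), P (u j)⟫_ℂ‖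
        ≤ (Finset.univ.erase i).card • (ε + η) :=
          Finset.sum_le_card_nsmul _ _ _ fun j hj => hoff i j (Finset.ne_of_mem_erase hj).symm
      _ = (N - 1) * (ε + η) := by
          simp [Finset.card_erase_of_mem, Nat.cast_sub hN, mul_add]
      _ < 1 - η := by nlinarith [mul_nonneg N.cast_nonneg hη]
  simpa [hR] using hv.fintype_card_le_finrank
end
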